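/- arXiv:0804.1485 — 3 statements merged into one kernel-verified Lean document; each statement's English description precedes it below -/
import Mathlib

section
/- Let i, j ∈ I and w, w̃ ∈ W. If wα_i = w̃α_j, then w^∨α_i^∨ = w̃^∨α_j^∨, where for w ∈ W, w^∨ denotes the induced map on linear functionals given by (w^∨h)(x) = h(w^{−1}x). -/
namespace GKM

variable {I V : Type*} [AddCommGroup V] [Module ℚ V]

/-- The simple "reflection" `r_i : x ↦ x - α_i^∨(x) • α_i` (an endomorphism of `h*`). -/
def srefl (α : I → V) (coroot : I → (V →ₗ[ℚ] ℚ)) (i : I) : Module.End ℚ V :=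
  LinearMap.id - (coroot i).smulRight (α i)

/-- The dual map `h ↦ h - h(α_i) • α_i^∨` on linear functionals; for a real index `i`
this is `r_i^∨ : h ↦ h ∘ r_i⁻¹ = h ∘ r_i`. -/
def crefl (α : I → V) (coroot : I → (V →ₗ[ℚ] ℚ)) (i : I) :
    Module.End ℚ (V →ₗ[ℚ] ℚ) :=
  LinearMap.id - (LinearMap.applyₗ (α i)).smulRight (coroot i)

/-- The monoid `T` generated by all the `r_i`, `i ∈ I`. -/
def Tmon (α : I → V) (coroot : I → (V →ₗ[ℚ] ℚ)) : Submonoid (Module.End ℚ V) :=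
  Submonoid.closure (Set.range (srefl α coroot))

/-- The Weyl group `W` generated by the `r_i` with `i` real; since each generator is an
involution, the submonoid it generates coincides with the group it generates. -/
def Wmon (A : I → I → ℤ) (α : I → V) (coroot : I → (V →ₗ[ℚ] ℚ)) :
    Submonoid (Module.End ℚ V) :=
  Submonoid.closure (srefl α coroot '' {i | A i i = 2})

/-- `Q^+`, the set of `ℕ`-linear combinations of simple roots. -/
def Qplus (α : I → V) : Set V :=
  {x | ∃ c : I →₀ ℕ, x = c.sum fun i n => (n : ℚ) • α i}

/-- The weight lattice `P`. -/
def Pint (coroot : I → (V →ₗ[ℚ] ℚ)) : Set V :=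
  {x | ∀ i, ∃ n : ℤ, coroot i x = (n : ℚ)}

/-- The dominant integral weights `P^+`. -/
def Pplus (coroot : I → (V →ₗ[ℚ] ℚ)) : Set V :=
  {x | (∀ i, ∃ n : ℤ, coroot i x = (n : ℚ)) ∧ ∀ i, 0 ≤ coroot i x}

/-- The orbit `Tλ`. -/
def Torbit (α : I → V) (coroot : I → (V →ₗ[ℚ] ℚ)) (lam : V) : Set V :=
  {x | ∃ τ, τ ∈ Tmon α coroot ∧ τ lam = x}

/-- The reduced length of `τ ∈ T` with respect to all generators `r_i`, `i ∈ I`. -/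
noncomputable def lenT (α : I → V) (coroot : I → (V →ₗ[ℚ] ℚ))
    (τ : Module.End ℚ V) : ℕ :=
  sInf {n | ∃ l : List I, l.length = n ∧ (l.map (srefl α coroot)).prod = τ}

/-- The reduced length of `w ∈ W` with respect to the real generators. -/
noncomputable def lenW (A : I → I → ℤ) (α : I → V) (coroot : I → (V →ₗ[ℚ] ℚ))
    (w : Module.End ℚ V) : ℕ :=
  sInf {n | ∃ l : List I, (∀ m ∈ l, A m m = 2) ∧ l.length = n ∧
    (l.map (srefl α coroot)).prod = w}

/-- The reflection `r_β : x ↦ x - β^∨(x) • β` attached to a root/coroot pair. -/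
def reflRoot (β : V) (βv : V →ₗ[ℚ] ℚ) : Module.End ℚ V :=
  LinearMap.id - βv.smulRight β

/-- A presentation of `β = w α_k ∈ WΠ` together with its coroot `β^∨ = w^∨ α_k^∨`,
via a word `l` (with real entries) for `w`. -/
def IsWRootPres (A : I → I → ℤ) (α : I → V) (coroot : I → (V →ₗ[ℚ] ℚ))
    (l : List I) (k : I) (β : V) (βv : V →ₗ[ℚ] ℚ) : Prop :=
  (∀ m ∈ l, A m m = 2) ∧
  β = (l.map (srefl α coroot)).prod (α k) ∧
  βv = (l.map (crefl α coroot)).prod (coroot k)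

/-- `β ∈ WΠ` with coroot `β^∨`. -/
def IsWRootPair (A : I → I → ℤ) (α : I → V) (coroot : I → (V →ₗ[ℚ] ℚ))
    (β : V) (βv : V →ₗ[ℚ] ℚ) : Prop :=
  ∃ l k, IsWRootPres A α coroot l k β βv

/-- A chain `ν =: c s ← ⋯ ← c 0 := μ` of length `s` inside `Tλ`:
`c k = r_{β k} (c (k+1))` with `β k ∈ WΠ ∩ Q^+` and `(β k)^∨(c (k+1)) > 0`. -/
def IsChain (A : I → I → ℤ) (α : I → V) (coroot : I → (V →ₗ[ℚ] ℚ))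
    (lam μ ν : V) (s : ℕ) (c : ℕ → V) (β : ℕ → V)
    (βv : ℕ → (V →ₗ[ℚ] ℚ)) : Prop :=
  c 0 = μ ∧ c s = ν ∧ (∀ k ≤ s, c k ∈ Torbit α coroot lam) ∧
  ∀ k < s, IsWRootPair A α coroot (β k) (βv k) ∧ β k ∈ Qplus α ∧
    0 < βv k (c (k+1)) ∧ c k = c (k+1) - βv k (c (k+1)) • β k

/-- `μ > ν` in `Tλ`. -/
def ChainGT (A : I → I → ℤ) (α : I → V) (coroot : I → (V →ₗ[ℚ] ℚ))
    (lam μ ν : V) : Prop :=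
  ∃ s, 1 ≤ s ∧ ∃ c β βv, IsChain A α coroot lam μ ν s c β βv

/-- `dist(μ, ν) = n`: there is a chain of length `n` from `μ` to `ν` and every chain
has length at most `n`. -/
def distEq (A : I → I → ℤ) (α : I → V) (coroot : I → (V →ₗ[ℚ] ℚ))
    (lam μ ν : V) (n : ℕ) : Prop :=
  (∃ c β βv, IsChain A α coroot lam μ ν n c β βv) ∧
  ∀ m c β βv, IsChain A α coroot lam μ ν m c β βv → m ≤ n

/-- An `a`-chain for `(μ, ν)`: a chain in which each step is a covering
(`dist = 1`), `a·β_k^∨(ν_k)` is a positive integer for steps along `WΠ_re`,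
and `a·β_k^∨(ν_k) = 1` for steps along `WΠ_im`.  The index `ks k` records the simple
root of which `β k` is a `W`-translate. -/
def IsAChain (A : I → I → ℤ) (α : I → V) (coroot : I → (V →ₗ[ℚ] ℚ))
    (lam : V) (a : ℚ) (μ ν : V) (s : ℕ) (c : ℕ → V)
    (β : ℕ → V) (βv : ℕ → (V →ₗ[ℚ] ℚ)) (ks : ℕ → I) : Prop :=
  1 ≤ s ∧ IsChain A α coroot lam μ ν s c β βv ∧
  ∀ k < s,
    (∃ l, IsWRootPres A α coroot l (ks k) (β k) (βv k)) ∧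
    distEq A α coroot lam (c k) (c (k+1)) 1 ∧
    (A (ks k) (ks k) = 2 → ∃ n : ℕ, 0 < n ∧ a * βv k (c (k+1)) = (n : ℚ)) ∧
    (A (ks k) (ks k) ≠ 2 → a * βv k (c (k+1)) = 1)

/-- Existence of an `a`-chain for `(μ, ν)`. -/
def HasAChain (A : I → I → ℤ) (α : I → V) (coroot : I → (V →ₗ[ℚ] ℚ))
    (lam : V) (a : ℚ) (μ ν : V) : Prop :=
  ∃ s c β βv ks, IsAChain A α coroot lam a μ ν s c β βv ks

/-- The piecewise-linear path attached to GLS data `(λ_1, …, λ_s ; a_0, …, a_s)`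
(weights indexed `1, …, s`, breakpoints indexed `0, …, s`):
on `[a_{j-1}, a_j]` it equals `Σ_{k<j} (a_k - a_{k-1}) • λ_k + (t - a_{j-1}) • λ_j`. -/
def glsPath (lamseq : ℕ → V) (a : ℕ → ℚ) (s : ℕ) (t : ℚ) : V :=
  ∑ k ∈ Finset.range s, (max (min t (a (k+1)) - a k) 0) • lamseq (k+1)

/-- The data of a Generalized Lakshmibai–Seshadri path of shape `lam`. -/
def IsGLS (A : I → I → ℤ) (α : I → V) (coroot : I → (V →ₗ[ℚ] ℚ))
    (lam : V) (s : ℕ) (lamseq : ℕ → V) (a : ℕ → ℚ) : Prop :=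
  1 ≤ s ∧ a 0 = 0 ∧ a s = 1 ∧ (∀ k < s, a k < a (k+1)) ∧
  (∀ k, 1 ≤ k → k ≤ s → lamseq k ∈ Torbit α coroot lam) ∧
  (∀ k, 1 ≤ k → k < s →
    HasAChain A α coroot lam (a k) (lamseq k) (lamseq (k+1))) ∧
  (lamseq s = lam ∨ HasAChain A α coroot lam 1 (lamseq s) lam)

/-- The set `ℙ_λ` of Generalized Lakshmibai–Seshadri paths of shape `lam`,
realized as functions `ℚ → V` via `glsPath`. -/
def GLSset (A : I → I → ℤ) (α : I → V) (coroot : I → (V →ₗ[ℚ] ℚ))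
    (lam : V) : Set (ℚ → V) :=
  {π | ∃ s lamseq a, IsGLS A α coroot lam s lamseq a ∧ π = glsPath lamseq a s}

/-- `h_i^π(t) = α_i^∨(π(t))`. -/
def hFun (coroot : I → (V →ₗ[ℚ] ℚ)) (i : I) (π : ℚ → V) (t : ℚ) : ℚ :=
  coroot i (π t)

/-- `m_i^π`, the minimal integer value attained by `h_i^π` on `[0,1]`. -/
noncomputable def mOf (coroot : I → (V →ₗ[ℚ] ℚ)) (i : I) (π : ℚ → V) : ℤ :=
  sInf {n : ℤ | ∃ t, 0 ≤ t ∧ t ≤ 1 ∧ hFun coroot i π t = (n : ℚ)}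

/-- Two paths agree on `[0,1]`. -/
def pathEq (π π' : ℚ → V) : Prop := ∀ t, 0 ≤ t → t ≤ 1 → π t = π' t

/-- `tp = f_+^i(π)`: the largest point of `[0,1]` where `h_i^π` equals `m_i^π`. -/
def IsFPlus (coroot : I → (V →ₗ[ℚ] ℚ)) (i : I) (π : ℚ → V) (tp : ℚ) : Prop :=
  0 ≤ tp ∧ tp ≤ 1 ∧ hFun coroot i π tp = (mOf coroot i π : ℚ) ∧
  ∀ t, 0 ≤ t → t ≤ 1 → hFun coroot i π t = (mOf coroot i π : ℚ) → t ≤ tp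

/-- `tm = f_-^i(π)`: the smallest point of `[tp,1]` where `h_i^π` equals `m_i^π + 1`. -/
def IsFMinus (coroot : I → (V →ₗ[ℚ] ℚ)) (i : I) (π : ℚ → V) (tp tm : ℚ) : Prop :=
  tp ≤ tm ∧ tm ≤ 1 ∧ hFun coroot i π tm = (mOf coroot i π : ℚ) + 1 ∧
  ∀ t, tp ≤ t → t ≤ 1 → hFun coroot i π t = (mOf coroot i π : ℚ) + 1 → tm ≤ t

/-- The path `f_i π` (for cutting data `tp = f_+^i(π)`, `tm = f_-^i(π)`). -/
def fPath (α : I → V) (coroot : I → (V →ₗ[ℚ] ℚ)) (i : I) (tp tm : ℚ)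
    (π : ℚ → V) (t : ℚ) : V :=
  if t ≤ tp then π t
  else if t ≤ tm then π tp + srefl α coroot i (π t - π tp)
  else π t - α i

/-- `π' = f_i π ≠ 0` (equality of paths on `[0,1]`). -/
def FRel (α : I → V) (coroot : I → (V →ₗ[ℚ] ℚ)) (i : I) (π π' : ℚ → V) : Prop :=
  ∃ tp tm, IsFPlus coroot i π tp ∧ tp < 1 ∧ IsFMinus coroot i π tp tm ∧
    pathEq π' (fPath α coroot i tp tm π)

/-- `tp = e_+^i(π)` (`i` real): smallest point of `[0,1]` where `h_i^π = m_i^π`. -/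
def IsEPlusRe (coroot : I → (V →ₗ[ℚ] ℚ)) (i : I) (π : ℚ → V) (tp : ℚ) : Prop :=
  0 ≤ tp ∧ tp ≤ 1 ∧ hFun coroot i π tp = (mOf coroot i π : ℚ) ∧
  ∀ t, 0 ≤ t → t ≤ 1 → hFun coroot i π t = (mOf coroot i π : ℚ) → tp ≤ t

/-- `tm = e_-^i(π)` (`i` real): largest point of `[0,tp]` where `h_i^π = m_i^π + 1`. -/
def IsEMinusRe (coroot : I → (V →ₗ[ℚ] ℚ)) (i : I) (π : ℚ → V) (tp tm : ℚ) : Prop :=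
  0 ≤ tm ∧ tm ≤ tp ∧ hFun coroot i π tm = (mOf coroot i π : ℚ) + 1 ∧
  ∀ t, 0 ≤ t → t ≤ tp → hFun coroot i π t = (mOf coroot i π : ℚ) + 1 → t ≤ tm

/-- The path `e_i π` for `i` real. -/
def ePathRe (α : I → V) (coroot : I → (V →ₗ[ℚ] ℚ)) (i : I) (tm tp : ℚ)
    (π : ℚ → V) (t : ℚ) : V :=
  if t ≤ tm then π t
  else if t ≤ tp then π tm + srefl α coroot i (π t - π tm)
  else π t + α i

/-- `π' = e_i π ≠ 0` for a real index `i`. -/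
def ERelRe (α : I → V) (coroot : I → (V →ₗ[ℚ] ℚ)) (i : I) (π π' : ℚ → V) : Prop :=
  ∃ tp tm, IsEPlusRe coroot i π tp ∧ 0 < tp ∧ IsEMinusRe coroot i π tp tm ∧
    pathEq π' (ePathRe α coroot i tm tp π)

/-- The "inverse reflection" `r_i^{-1} : x ↦ x + (1/(1-a_{ii})) α_i^∨(x) α_i`
for an imaginary index `i`. -/
def rinv (A : I → I → ℤ) (α : I → V) (coroot : I → (V →ₗ[ℚ] ℚ)) (i : I) :
    Module.End ℚ V :=
  LinearMap.id + (1 / (1 - (A i i : ℚ))) • (coroot i).smulRight (α i)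

/-- `tp = e_+^i(π)` (`i` imaginary): smallest point of `[tm,1]` where
`h_i^π = m_i^π + 1 - a_{ii}` (here `tm = e_-^i(π) = f_+^i(π)`). -/
def IsEPlusIm (A : I → I → ℤ) (coroot : I → (V →ₗ[ℚ] ℚ)) (i : I) (π : ℚ → V)
    (tm tp : ℚ) : Prop :=
  tm ≤ tp ∧ tp ≤ 1 ∧
  hFun coroot i π tp = (mOf coroot i π : ℚ) + 1 - (A i i : ℚ) ∧
  ∀ t, tm ≤ t → t ≤ 1 →
    hFun coroot i π t = (mOf coroot i π : ℚ) + 1 - (A i i : ℚ) → tp ≤ t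

/-- The path `e_i π` for `i` imaginary. -/
def ePathIm (A : I → I → ℤ) (α : I → V) (coroot : I → (V →ₗ[ℚ] ℚ)) (i : I)
    (tm tp : ℚ) (π : ℚ → V) (t : ℚ) : V :=
  if t ≤ tm then π t
  else if t ≤ tp then π tm + rinv A α coroot i (π t - π tm)
  else π t + α i

/-- `π' = e_i π ≠ 0` for an imaginary index `i`:  `e_-^i(π) = f_+^i(π) < 1`, the point
`e_+^i(π)` exists, and `h_i^π` never drops to `m_i^π - a_{ii}` on `[e_+^i(π), 1]`. -/
def ERelIm (A : I → I → ℤ) (α : I → V) (coroot : I → (V →ₗ[ℚ] ℚ)) (i : I)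
    (π π' : ℚ → V) : Prop :=
  ∃ tm tp, IsFPlus coroot i π tm ∧ tm < 1 ∧ IsEPlusIm A coroot i π tm tp ∧
    (∀ t, tp ≤ t → t ≤ 1 →
      (mOf coroot i π : ℚ) - (A i i : ℚ) < hFun coroot i π t) ∧
    pathEq π' (ePathIm A α coroot i tm tp π)

/-- `π' = e_i π ≠ 0`. -/
def ERel (A : I → I → ℤ) (α : I → V) (coroot : I → (V →ₗ[ℚ] ℚ)) (i : I)
    (π π' : ℚ → V) : Prop :=
  (A i i = 2 ∧ ERelRe α coroot i π π') ∨ (A i i ≠ 2 ∧ ERelIm A α coroot i π π')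

/-- `π' = f_{i_1} ⋯ f_{i_k} π ≠ 0` for a list `[i_1, …, i_k]` (rightmost acts first). -/
def FMonRel (α : I → V) (coroot : I → (V →ₗ[ℚ] ℚ)) :
    List I → (ℚ → V) → (ℚ → V) → Prop
  | [], π, π' => pathEq π π'
  | i :: l, π, π' => ∃ πm, FMonRel α coroot l π πm ∧ FRel α coroot i πm π'

/-- A generalized crystal for the Borcherds–Cartan datum `(A, α, coroot)`. -/
structure GenCrystal (A : I → I → ℤ) (α : I → V)
    (coroot : I → (V →ₗ[ℚ] ℚ)) where
  B : Type*
  wt : B → V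
  wt_int : ∀ (i : I) (b : B), ∃ n : ℤ, coroot i (wt b) = (n : ℚ)
  eps : I → B → WithBot ℤ
  phi : I → B → WithBot ℤ
  e : I → B → Option B
  f : I → B → Option B
  phi_eq : ∀ (i : I) (b : B) (n : ℤ), (n : ℚ) = coroot i (wt b) →
    phi i b = eps i b + (n : WithBot ℤ)
  wt_e : ∀ (i : I) (b b' : B), e i b = some b' → wt b' = wt b + α i
  eps_e_re : ∀ (i : I) (b b' : B), A i i = 2 → e i b = some b' →
    eps i b' = eps i b + ((-1 : ℤ) : WithBot ℤ)
  eps_e_im : ∀ (i : I) (b b' : B), A i i ≠ 2 → e i b = some b' →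
    eps i b' = eps i b
  e_iff_f : ∀ (i : I) (b b' : B), e i b = some b' ↔ f i b' = some b
  phi_bot : ∀ (i : I) (b : B), phi i b = ⊥ → e i b = none ∧ f i b = none
  eps_im : ∀ (i : I) (b : B), A i i ≠ 2 → eps i b ≤ 0
  phi_im : ∀ (i : I) (b : B), A i i ≠ 2 → phi i b = ⊥ ∨ 0 ≤ phi i b

/-- Finite "orthogonal" subsets of the imaginary simple roots, encoded by their
index sets: `F ∈ 𝒫(Π_im)`. -/
def PImSet (A : I → I → ℤ) (F : Finset I) : Prop :=
  (∀ i ∈ F, A i i ≠ 2) ∧ ∀ i ∈ F, ∀ j ∈ F, i ≠ j → A i j = 0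

end GKM

namespace GKM

/-- `(A, α, coroot)` is a realization of the Borcherds–Cartan matrix `A`. -/
structure IsRealization {I V : Type*} [AddCommGroup V] [Module ℚ V]
    (A : I → I → ℤ) (α : I → V) (coroot : I → (V →ₗ[ℚ] ℚ)) : Prop where
  linearIndependent : LinearIndependent ℚ α
  coroot_root : ∀ i j, coroot i (α j) = (A i j : ℚ)
  diag : ∀ i, A i i = 2 ∨ A i i ≤ 0
  off_diag : ∀ i j, i ≠ j → A i j ≤ 0
  zero_iff : ∀ i j, A i j = 0 ↔ A j i = 0

/-- The product of the simple reflections along a word. -/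
def wordProd {I V : Type*} [AddCommGroup V] [Module ℚ V]
    (α : I → V) (coroot : I → (V →ₗ[ℚ] ℚ)) (l : List I) : Module.End ℚ V :=
  (l.map (srefl α coroot)).prod

/-- All letters of the word are real. -/
def IsRealWord {I : Type*} (A : I → I → ℤ) (l : List I) : Prop := ∀ m ∈ l, A m m = 2

/-- A real word of minimal length among the real words with the same product. -/
def IsReducedWord {I V : Type*} [AddCommGroup V] [Module ℚ V]
    (A : I → I → ℤ) (α : I → V) (coroot : I → (V →ₗ[ℚ] ℚ)) (l : List I) : Prop :=
  IsRealWord A l ∧ ∀ l', IsRealWord A l' →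
    wordProd α coroot l' = wordProd α coroot l → l.length ≤ l'.length

/-- A nonnegative rational combination of simple roots. -/
def IsNonneg {I V : Type*} [AddCommGroup V] [Module ℚ V] (α : I → V) (v : V) : Prop :=
  ∃ c : I →₀ ℚ, (∀ k, 0 ≤ c k) ∧ Finsupp.linearCombination ℚ α c = v

section Nonneg

variable {I V : Type*} [AddCommGroup V] [Module ℚ V] {α : I → V}

theorem IsNonneg.root (α : I → V) (k : I) : IsNonneg α (α k) := by
  refine ⟨Finsupp.single k 1, fun m => ?_, by simp⟩
  exact (Finsupp.single_nonneg.2 zero_le_one : (0 : I →₀ ℚ) ≤ _) m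

theorem IsNonneg.zero (α : I → V) : IsNonneg α 0 := ⟨0, fun _ => le_rfl, by simp⟩

theorem IsNonneg.add {v w : V} (hv : IsNonneg α v) (hw : IsNonneg α w) :
    IsNonneg α (v + w) := by
  obtain ⟨c, hc, rfl⟩ := hv
  obtain ⟨d, hd, rfl⟩ := hw
  exact ⟨c + d, fun k => add_nonneg (hc k) (hd k), by simp⟩

theorem IsNonneg.smul {v : V} (hv : IsNonneg α v) {q : ℚ} (hq : 0 ≤ q) :
    IsNonneg α (q • v) := by
  obtain ⟨c, hc, rfl⟩ := hv
  exact ⟨q • c, fun k => mul_nonneg hq (hc k), by simp⟩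

theorem IsNonneg.eq_zero_of_add_eq_zero (hα : LinearIndependent ℚ α) {v w : V}
    (hv : IsNonneg α v) (hw : IsNonneg α w) (h : v + w = 0) : v = 0 := by
  obtain ⟨c, hc, rfl⟩ := hv
  obtain ⟨d, hd, rfl⟩ := hw
  rw [← map_add] at h
  have hcd : c + d = 0 := (linearIndependent_iff.1 hα) _ h
  have : c = 0 := by
    ext k
    have := DFunLike.congr_fun hcd k
    simp only [Finsupp.add_apply, Finsupp.zero_apply] at this ⊢
    linarith [hc k, hd k]
  simp [this]

/-- A simple root plus a multiple of a different one is not the negative of a nonnegative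
combination. -/
theorem not_isNonneg_neg_root_add (hα : LinearIndependent ℚ α) {k m : I} (hkm : k ≠ m) (q : ℚ) :
    ¬ IsNonneg α (-(α k + q • α m)) := by
  rintro ⟨c, hc, hcv⟩
  have : Finsupp.linearCombination ℚ α (c + (Finsupp.single k 1 + Finsupp.single m q)) = 0 := by
    simp [hcv]
  have h0 := DFunLike.congr_fun ((linearIndependent_iff.1 hα) _ this) k
  simp [hkm.symm] at h0
  linarith [hc k]

end Nonneg

section Words

variable {I V : Type*} [AddCommGroup V] [Module ℚ V]
  {A : I → I → ℤ} {α : I → V} {coroot : I → (V →ₗ[ℚ] ℚ)}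

theorem srefl_apply (k : I) (x : V) : srefl α coroot k x = x - coroot k x • α k := by
  simp [srefl]

theorem crefl_apply (k : I) (f : V →ₗ[ℚ] ℚ) :
    crefl α coroot k f = f ∘ₗ srefl α coroot k := by
  ext x
  simp [crefl, srefl, mul_comm]

@[simp] theorem wordProd_nil : wordProd α coroot [] = 1 := rfl

@[simp] theorem wordProd_cons (k : I) (l : List I) :
    wordProd α coroot (k :: l) = srefl α coroot k * wordProd α coroot l := by
  simp [wordProd]

@[simp] theorem wordProd_append (l l' : List I) :
    wordProd α coroot (l ++ l') = wordProd α coroot l * wordProd α coroot l' := by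
  simp [wordProd]

theorem crefl_prod_apply (l : List I) (f : V →ₗ[ℚ] ℚ) :
    (l.map (crefl α coroot)).prod f = f ∘ₗ wordProd α coroot l.reverse := by
  induction l with
  | nil => ext; simp
  | cons k l ih =>
    rw [List.map_cons, List.prod_cons, Module.End.mul_apply, ih, crefl_apply]
    ext x
    simp

theorem IsRealWord.append {l l' : List I} (hl : IsRealWord A l) (hl' : IsRealWord A l') :
    IsRealWord A (l ++ l') := by
  intro m hm
  rcases List.mem_append.1 hm with h | h
  exacts [hl m h, hl' m h]

theorem IsRealWord.cons {k : I} {l : List I} (hk : A k k = 2) (hl : IsRealWord A l) :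
    IsRealWord A (k :: l) := by
  intro m hm
  rcases List.mem_cons.1 hm with h | h
  exacts [h ▸ hk, hl m h]

theorem IsRealWord.singleton {k : I} (hk : A k k = 2) : IsRealWord A [k] :=
  IsRealWord.cons hk (fun _ h => absurd h List.not_mem_nil)

theorem IsRealWord.left {l l' : List I} (h : IsRealWord A (l ++ l')) : IsRealWord A l :=
  fun m hm => h m (List.mem_append_left _ hm)

theorem IsRealWord.right {l l' : List I} (h : IsRealWord A (l ++ l')) : IsRealWord A l' :=
  fun m hm => h m (List.mem_append_right _ hm)

theorem IsRealWord.reverse {l : List I} (hl : IsRealWord A l) : IsRealWord A l.reverse :=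
  fun m hm => hl m (List.mem_reverse.1 hm)

theorem exists_isReducedWord {l : List I} (hl : IsRealWord A l) :
    ∃ l', IsReducedWord A α coroot l' ∧ wordProd α coroot l' = wordProd α coroot l := by
  obtain ⟨l', ⟨h1, h2⟩, h3⟩ := exists_minimalFor_of_wellFoundedLT
    (fun l' => IsRealWord A l' ∧ wordProd α coroot l' = wordProd α coroot l) List.length
    ⟨l, hl, rfl⟩
  refine ⟨l', ⟨h1, fun l'' hr hp => ?_⟩, h2⟩
  rcases le_total l'.length l''.length with h | h
  · exact h
  · exact h3 ⟨hr, hp.trans h2⟩ h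

theorem IsReducedWord.left {l l' : List I} (h : IsReducedWord A α coroot (l ++ l')) :
    IsReducedWord A α coroot l := by
  refine ⟨h.1.left, fun l'' hr hp => ?_⟩
  have := h.2 (l'' ++ l') (hr.append h.1.right) (by simp [hp])
  simpa using this

theorem mul_srefl_of_intertwines {M : Module.End ℚ V} {s k : I} (hα : M (α s) = α k)
    (hc : ∀ v, coroot k (M v) = coroot s v) :
    M * srefl α coroot s = srefl α coroot k * M := by
  ext v
  simp [srefl_apply, hα, hc]

end Words

namespace IsRealization

variable {I V : Type*} [AddCommGroup V] [Module ℚ V]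
  {A : I → I → ℤ} {α : I → V} {coroot : I → (V →ₗ[ℚ] ℚ)}

theorem srefl_root (H : IsRealization A α coroot) (k m : I) :
    srefl α coroot k (α m) = α m - (A k m : ℚ) • α k := by
  rw [srefl_apply, H.coroot_root]

theorem srefl_root_self (H : IsRealization A α coroot) {k : I} (hk : A k k = 2) :
    srefl α coroot k (α k) = -α k := by
  rw [H.srefl_root, hk]
  push_cast
  module

theorem srefl_mul_self (H : IsRealization A α coroot) {k : I} (hk : A k k = 2) :
    srefl α coroot k * srefl α coroot k = 1 := by
  ext v
  rw [Module.End.mul_apply, srefl_apply k v, map_sub, map_smul, H.srefl_root_self hk, srefl_apply]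
  simp

theorem wordProd_reverse_mul (H : IsRealization A α coroot) {l : List I} (hl : IsRealWord A l) :
    wordProd α coroot l.reverse * wordProd α coroot l = 1 := by
  induction l with
  | nil => simp
  | cons k l ih =>
    have hk := hl k List.mem_cons_self
    have ih := ih fun m hm => hl m (List.mem_cons_of_mem _ hm)
    simp only [List.reverse_cons, wordProd_append, wordProd_cons, wordProd_nil, mul_one]
    rw [mul_assoc, ← mul_assoc (srefl α coroot k), H.srefl_mul_self hk, one_mul, ih]

theorem wordProd_mul_reverse (H : IsRealization A α coroot) {l : List I} (hl : IsRealWord A l) :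
    wordProd α coroot l * wordProd α coroot l.reverse = 1 := by
  simpa using H.wordProd_reverse_mul hl.reverse

theorem wordProd_apply_eq_zero (H : IsRealization A α coroot) {l : List I}
    (hl : IsRealWord A l) {v : V} (hv : wordProd α coroot l v = 0) : v = 0 := by
  have := LinearMap.congr_fun (H.wordProd_reverse_mul hl) v
  simpa [hv] using this.symm

theorem exists_symmetrizer (H : IsRealization A α coroot) {s t : I} (hst : s ≠ t) :
    ∃ ds dt : ℤ, 0 < ds ∧ 0 < dt ∧ ds * A s t = dt * A t s := by
  by_cases h : A s t = 0
  · exact ⟨1, 1, one_pos, one_pos, by rw [h, (H.zero_iff s t).1 h]⟩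
  · have h' : A t s ≠ 0 := fun h0 => h ((H.zero_iff t s).1 h0)
    have h1 := H.off_diag s t hst
    have h2 := H.off_diag t s hst.symm
    exact ⟨-A t s, -A s t, by lia, by lia, by ring⟩

end IsRealization

/-- `M` sends `α s` to `x • α s + y • α t`, compatibly with the coroots, where `x, y` are coprime
and the symmetrized quadratic form takes the same value at both vectors. -/
structure IsRankTwoImage {I V : Type*} [AddCommGroup V] [Module ℚ V]
    (A : I → I → ℤ) (α : I → V) (coroot : I → (V →ₗ[ℚ] ℚ)) (s t : I) (ds dt : ℤ)
    (M : Module.End ℚ V) (x y : ℤ) : Prop where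
  root : M (α s) = (x : ℚ) • α s + (y : ℚ) • α t
  coprime : IsCoprime x y
  form : ds * x ^ 2 + ds * A s t * x * y + dt * y ^ 2 = ds
  coroot : ∀ v, (x * ds : ℚ) * coroot s (M v) + (y * dt : ℚ) * coroot t (M v) = ds * coroot s v

namespace IsRankTwoImage

variable {I V : Type*} [AddCommGroup V] [Module ℚ V]
  {A : I → I → ℤ} {α : I → V} {coroot : I → (V →ₗ[ℚ] ℚ)} {s t : I} {ds dt : ℤ}
  {M : Module.End ℚ V} {x y : ℤ}

theorem one : IsRankTwoImage A α coroot s t ds dt 1 1 0 where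
  root := by simp
  coprime := isCoprime_one_left
  form := by ring
  coroot v := by simp

theorem srefl_left (H : IsRealization A α coroot) (hs : A s s = 2)
    (hd : ds * A s t = dt * A t s) (h : IsRankTwoImage A α coroot s t ds dt M x y) :
    IsRankTwoImage A α coroot s t ds dt (srefl α coroot s * M) (-x - A s t * y) y where
  root := by
    rw [Module.End.mul_apply, h.root, map_add, map_smul, map_smul, H.srefl_root_self hs,
      H.srefl_root]
    push_cast
    module
  coprime := by
    have : -x - A s t * y = -(x + A s t * y) := by ring
    rw [this]
    exact (h.coprime.add_mul_right_left _).neg_left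
  form := by linear_combination h.form
  coroot v := by
    have hd' : (ds * A s t : ℚ) = dt * A t s := by exact_mod_cast hd
    have := h.coroot v
    simp only [Module.End.mul_apply, srefl_apply, map_sub, map_smul, H.coroot_root, smul_eq_mul, hs]
    push_cast
    linear_combination this + (y * coroot s (M v)) * hd'

theorem srefl_right (H : IsRealization A α coroot) (ht : A t t = 2)
    (hd : ds * A s t = dt * A t s) (h : IsRankTwoImage A α coroot s t ds dt M x y) :
    IsRankTwoImage A α coroot s t ds dt (srefl α coroot t * M) x (-y - A t s * x) where
  root := by
    rw [Module.End.mul_apply, h.root, map_add, map_smul, map_smul, H.srefl_root_self ht,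
      H.srefl_root]
    push_cast
    module
  coprime := by
    have : -y - A t s * x = -(y + A t s * x) := by ring
    rw [this]
    exact (h.coprime.add_mul_right_right _).neg_right
  form := by linear_combination h.form - (2 * x * y + A t s * x ^ 2) * hd
  coroot v := by
    have hd' : (ds * A s t : ℚ) = dt * A t s := by exact_mod_cast hd
    have := h.coroot v
    simp only [Module.End.mul_apply, srefl_apply, map_sub, map_smul, H.coroot_root, smul_eq_mul, ht]
    push_cast
    linear_combination this - (x * coroot t (M v)) * hd'

/-- The coordinates `x`, `y` never have strictly opposite signs. -/
theorem not_mixed (hs : 0 < ds) (ht : 0 < dt) (hA : A s t ≤ 0)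
    (h : IsRankTwoImage A α coroot s t ds dt M x y) : 0 ≤ x * y := by
  by_contra! hxy
  have hx : 0 < x ^ 2 := sq_pos_of_ne_zero (by rintro rfl; simp at hxy)
  have hy : 0 < y ^ 2 := sq_pos_of_ne_zero (by rintro rfl; simp at hxy)
  have h1 : 0 ≤ (ds * -A s t) * -(x * y) :=
    mul_nonneg (mul_nonneg hs.le (by lia)) (by lia)
  nlinarith [h.form]

end IsRankTwoImage

namespace IsRealization

variable {I V : Type*} [AddCommGroup V] [Module ℚ V]
  {A : I → I → ℤ} {α : I → V} {coroot : I → (V →ₗ[ℚ] ℚ)}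

/-- In the rank two parabolic subgroup of `s` and `t`, either `u α_s` is a nonnegative
combination of `α_s` and `α_t`, or `u r_s` is shorter than `u`. -/
theorem exists_isRankTwoImage (H : IsRealization A α coroot) {s t : I} (hst : s ≠ t)
    (hs : A s s = 2) (ht : A t t = 2) {ds dt : ℤ} (hds : 0 < ds) (hdt : 0 < dt)
    (hd : ds * A s t = dt * A t s) (u : List I) (hu : ∀ m ∈ u, m = s ∨ m = t) :
    ∃ x y : ℤ, IsRankTwoImage A α coroot s t ds dt (wordProd α coroot u) x y ∧
      ((0 ≤ x ∧ 0 ≤ y) ∨ ∃ u' : List I, (∀ m ∈ u', m = s ∨ m = t) ∧ u'.length < u.length ∧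
        wordProd α coroot u' = wordProd α coroot u * srefl α coroot s) := by
  induction u with
  | nil => exact ⟨1, 0, .one, Or.inl ⟨zero_le_one, le_rfl⟩⟩
  | cons k u ih =>
    have hu' : ∀ m ∈ u, m = s ∨ m = t := fun m hm => hu m (List.mem_cons_of_mem _ hm)
    have hk := hu k List.mem_cons_self
    have hA := H.off_diag s t hst
    have hkk : A k k = 2 := by rcases hk with rfl | rfl <;> assumption
    obtain ⟨x, y, h, hxy⟩ := ih hu'
    obtain ⟨x', y', h', hkx⟩ : ∃ x' y', IsRankTwoImage A α coroot s t ds dt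
        (wordProd α coroot (k :: u)) x' y' ∧ ((k = s ∧ y' = y) ∨ (k = t ∧ x' = x)) := by
      rw [wordProd_cons]
      rcases hk with rfl | rfl
      · exact ⟨_, _, h.srefl_left H hs hd, Or.inl ⟨rfl, rfl⟩⟩
      · exact ⟨_, _, h.srefl_right H ht hd, Or.inr ⟨rfl, rfl⟩⟩
    refine ⟨x', y', h', ?_⟩
    rcases hxy with ⟨hx, hy⟩ | ⟨u', h1, h2, h3⟩
    · by_cases hpos : 0 ≤ x' ∧ 0 ≤ y'
      · exact Or.inl hpos
      have hmix := h'.not_mixed hds hdt hA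
      refine Or.inr ⟨u, hu', by simp, ?_⟩
      suffices hint : wordProd α coroot u * srefl α coroot s =
          srefl α coroot k * wordProd α coroot u by
        rw [wordProd_cons, mul_assoc, hint, ← mul_assoc, H.srefl_mul_self hkk, one_mul]
      have hds0 : (ds : ℚ) ≠ 0 := by exact_mod_cast hds.ne'
      rcases hkx with ⟨rfl, rfl⟩ | ⟨rfl, rfl⟩
      · have hx' : x' < 0 := by by_contra! hc; exact hpos ⟨hc, hy⟩
        obtain rfl : y' = 0 := by nlinarith
        obtain rfl : x = 1 := by
          have := Int.isUnit_iff.1 (isCoprime_zero_right.1 h.coprime)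
          lia
        refine mul_srefl_of_intertwines (by simpa using h.root) fun v => ?_
        have := h.coroot v
        push_cast at this
        exact mul_left_cancel₀ hds0 (by linear_combination this)
      · have hy' : y' < 0 := by by_contra! hc; exact hpos ⟨hx, hc⟩
        obtain rfl : x' = 0 := by nlinarith
        obtain rfl : y = 1 := by
          have := Int.isUnit_iff.1 (isCoprime_zero_left.1 h.coprime)
          lia
        obtain rfl : dt = ds := by linear_combination h.form
        refine mul_srefl_of_intertwines (by simpa using h.root) fun v => ?_
        have := h.coroot v
        push_cast at this
        exact mul_left_cancel₀ hds0 (by linear_combination this)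
    · refine Or.inr ⟨k :: u', ?_, by simpa using h2, by simp [h3, mul_assoc]⟩
      intro m hm
      rcases List.mem_cons.1 hm with rfl | hm
      exacts [hk, h1 m hm]

/-- If `r_s` does not shorten a reduced word `l`, then `l` sends `α_s` to a nonnegative
combination of simple roots. -/
theorem isNonneg_wordProd_root (H : IsRealization A α coroot) {l : List I} {s : I}
    (hl : IsReducedWord A α coroot l) (hs : A s s = 2)
    (hls : ∀ l', IsRealWord A l' →
      wordProd α coroot l' = wordProd α coroot l * srefl α coroot s → l.length ≤ l'.length) :
    IsNonneg α (wordProd α coroot l (α s)) := by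
  induction hn : l.length using Nat.strong_induction_on generalizing l s with
  | _ n ih =>
  subst hn
  rcases List.eq_nil_or_concat' l with rfl | ⟨l₀, t, rfl⟩
  · simpa using IsNonneg.root α s
  set l := l₀ ++ [t] with hldef
  have ht : A t t = 2 := hl.1 t (by simp [hldef])
  have hst : s ≠ t := by
    rintro rfl
    have := hls l₀ hl.1.left (by simp [hldef, mul_assoc, H.srefl_mul_self hs])
    simp [hldef] at this
  obtain ⟨ds, dt, hds, hdt, hd⟩ := H.exists_symmetrizer hst
  obtain ⟨v, ⟨u, hv, hu, hvu, hlen⟩, hmin⟩ := exists_minimalFor_of_wellFoundedLT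
    (fun v => ∃ u : List I, IsRealWord A v ∧ (∀ m ∈ u, m = s ∨ m = t) ∧
      wordProd α coroot v * wordProd α coroot u = wordProd α coroot l ∧
      v.length + u.length = l.length) List.length
    ⟨l₀, [t], hl.1.left, by simp, by simp [hldef], by simp [hldef]⟩
  have hreal : ∀ u' : List I, (∀ m ∈ u', m = s ∨ m = t) → IsRealWord A u' := by
    intro u' h m hm
    rcases h m hm with rfl | rfl <;> assumption
  have hvl : v.length < l.length := by
    have : v.length ≤ l₀.length := by
      rcases le_total v.length l₀.length with h | h
      · exact h
      · exact hmin ⟨[t], hl.1.left, by simp, by simp [hldef], by simp [hldef]⟩ h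
    simp only [hldef, List.length_append, List.length_singleton]
    lia
  have hvred : IsReducedWord A α coroot v := by
    refine ⟨hv, fun v' hv' hp => ?_⟩
    have := hl.2 (v' ++ u) (hv'.append (hreal u hu)) (by simp [hp, hvu])
    simp only [List.length_append] at this
    lia
  have key : ∀ k, k = s ∨ k = t → IsNonneg α (wordProd α coroot v (α k)) := by
    intro k hk
    have hkk : A k k = 2 := by rcases hk with rfl | rfl <;> assumption
    refine ih _ hvl hvred hkk (fun v' hv' hp => ?_) rfl
    by_contra! hlt
    have hku : ∀ m ∈ k :: u, m = s ∨ m = t := by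
      intro m hm
      rcases List.mem_cons.1 hm with rfl | hm
      exacts [hk, hu m hm]
    have hprod : wordProd α coroot v' * wordProd α coroot (k :: u) = wordProd α coroot l := by
      rw [hp, wordProd_cons, mul_assoc, ← mul_assoc (srefl α coroot k), H.srefl_mul_self hkk,
        one_mul, hvu]
    have h1 := hl.2 (v' ++ (k :: u)) (hv'.append (hreal _ hku)) (by rw [wordProd_append, hprod])
    simp only [List.length_append, List.length_cons] at h1
    have h2 := hmin ⟨k :: u, hv', hku, hprod, by simp only [List.length_cons]; lia⟩ hlt.le
    lia
  obtain ⟨x, y, hxy, ⟨hx, hy⟩ | ⟨u', hu', hlt, hp⟩⟩ :=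
    H.exists_isRankTwoImage hst hs ht hds hdt hd u hu
  · rw [← hvu, Module.End.mul_apply, hxy.root, map_add, map_smul, map_smul]
    exact ((key s (.inl rfl)).smul (by exact_mod_cast hx)).add
      ((key t (.inr rfl)).smul (by exact_mod_cast hy))
  · have := hls (v ++ u') (hv.append (hreal u' hu')) (by rw [wordProd_append, hp, ← mul_assoc, hvu])
    simp only [List.length_append] at this
    lia

theorem isNonneg_wordProd_root_of_concat (H : IsRealization A α coroot) {l : List I} {s : I}
    (h : IsReducedWord A α coroot (l ++ [s])) : IsNonneg α (wordProd α coroot l (α s)) := by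
  refine H.isNonneg_wordProd_root h.left (h.1 s (by simp)) fun l' hl' hp => ?_
  have := h.2 l' hl' (by simp [hp])
  simp only [List.length_append] at this
  lia

theorem isNonneg_or_isNonneg_neg (H : IsRealization A α coroot) {l : List I} {s : I}
    (hl : IsRealWord A l) (hs : A s s = 2) :
    IsNonneg α (wordProd α coroot l (α s)) ∨ IsNonneg α (-wordProd α coroot l (α s)) := by
  obtain ⟨l₁, h₁, hp₁⟩ := exists_isReducedWord (α := α) (coroot := coroot) hl
  obtain ⟨l₂, h₂, hp₂⟩ := exists_isReducedWord (α := α) (coroot := coroot)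
    (h₁.1.append (IsRealWord.singleton hs))
  have hp₂ : wordProd α coroot l₂ = wordProd α coroot l₁ * srefl α coroot s := by simpa using hp₂
  rw [← hp₁]
  rcases le_total l₁.length l₂.length with hle | hle
  · exact Or.inl (H.isNonneg_wordProd_root h₁ hs fun l' hl' hp =>
      hle.trans (h₂.2 l' hl' (hp.trans hp₂.symm)))
  · have hp : wordProd α coroot l₁ = wordProd α coroot l₂ * srefl α coroot s := by
      rw [hp₂, mul_assoc, H.srefl_mul_self hs, mul_one]
    have := H.isNonneg_wordProd_root h₂ hs fun l' hl' hp' =>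
      hle.trans (h₁.2 l' hl' (hp'.trans hp.symm))
    rw [hp₂, Module.End.mul_apply, H.srefl_root_self hs, map_neg] at this
    exact Or.inr this

/-- An element of the Weyl group keeping all real simple roots positive is trivial. -/
theorem wordProd_eq_one (H : IsRealization A α coroot) {l : List I} (hl : IsRealWord A l)
    (h : ∀ m, A m m = 2 → IsNonneg α (wordProd α coroot l (α m))) :
    wordProd α coroot l = 1 := by
  obtain ⟨l', hr, hp⟩ := exists_isReducedWord (α := α) (coroot := coroot) hl
  rw [← hp] at h ⊢
  rcases List.eq_nil_or_concat' l' with rfl | ⟨l₀, t, rfl⟩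
  · simp
  have ht : A t t = 2 := hr.1 t (by simp)
  have h1 := H.isNonneg_wordProd_root_of_concat hr
  have h2 := h t ht
  have h3 : wordProd α coroot (l₀ ++ [t]) (α t) = -wordProd α coroot l₀ (α t) := by
    simp [H.srefl_root_self ht]
  have h0 := H.wordProd_apply_eq_zero hr.1.left
    (h1.eq_zero_of_add_eq_zero H.linearIndependent h2 (by rw [h3, add_neg_cancel]))
  exact absurd h0 (H.linearIndependent.ne_zero t)

theorem coroot_comp_reverse_of_real (H : IsRealization A α coroot) {i j : I} {l : List I}
    (hl : IsRealWord A l) (hi : A i i = 2) (hj : A j j = 2)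
    (h : wordProd α coroot l (α i) = α j) :
    coroot i ∘ₗ wordProd α coroot l.reverse = coroot j := by
  set f := coroot i ∘ₗ wordProd α coroot l.reverse with hf
  have hword : ∀ v, wordProd α coroot ([j] ++ (l ++ ([i] ++ l.reverse))) v =
      v + (f v - coroot j v) • α j := by
    intro v
    have hv : wordProd α coroot l (wordProd α coroot l.reverse v) = v :=
      LinearMap.congr_fun (H.wordProd_mul_reverse hl) v
    simp only [wordProd_append, wordProd_cons, wordProd_nil, mul_one, Module.End.mul_apply]
    rw [srefl_apply i, map_sub, hv, map_smul, h, map_sub, map_smul, H.srefl_root_self hj,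
      srefl_apply, hf, LinearMap.comp_apply]
    module
  have hreal : IsRealWord A ([j] ++ (l ++ ([i] ++ l.reverse))) :=
    (IsRealWord.singleton hj).append (hl.append ((IsRealWord.singleton hi).append hl.reverse))
  have hfj : f (α j) = 2 := by
    have hrev : wordProd α coroot l.reverse (α j) = α i := by
      rw [← h]
      exact LinearMap.congr_fun (H.wordProd_reverse_mul hl) (α i)
    rw [hf, LinearMap.comp_apply, hrev, H.coroot_root, hi]
    norm_num
  have hone := H.wordProd_eq_one hreal fun m hm => by
    by_cases hmj : m = j
    · subst hmj
      rw [hword, hfj, H.coroot_root, hm]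
      simpa using IsNonneg.root α m
    · refine (H.isNonneg_or_isNonneg_neg hreal hm).resolve_right fun hneg => ?_
      rw [hword] at hneg
      exact not_isNonneg_neg_root_add H.linearIndependent hmj _ hneg
  ext v
  have h0 : (f v - coroot j v) • α j = 0 := by
    have := hword v
    rw [hone, Module.End.one_apply] at this
    exact left_eq_add.1 this
  exact sub_eq_zero.1 ((smul_eq_zero.1 h0).resolve_right (H.linearIndependent.ne_zero j))

/-- A reduced word moves an imaginary simple root up, and fixes it only if all letters are
orthogonal to it. -/
theorem isNonneg_wordProd_sub (H : IsRealization A α coroot) {i : I} (hi : A i i ≠ 2)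
    {l : List I} (hl : IsReducedWord A α coroot l) :
    IsNonneg α (wordProd α coroot l (α i) - α i) ∧
      (wordProd α coroot l (α i) = α i → ∀ m ∈ l, A i m = 0) := by
  induction l using List.reverseRecOn with
  | nil => simpa using IsNonneg.zero α
  | append_singleton l t ih =>
    obtain ⟨ih₁, ih₂⟩ := ih hl.left
    have ht : A t t = 2 := hl.1 t (by simp)
    have hti : A t i ≤ 0 := H.off_diag t i (by rintro rfl; exact hi ht)
    have hpos : IsNonneg α ((-A t i : ℚ) • wordProd α coroot l (α t)) :=
      (H.isNonneg_wordProd_root_of_concat hl).smul (by rw [neg_nonneg]; exact_mod_cast hti)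
    have heq : wordProd α coroot (l ++ [t]) (α i) - α i =
        (wordProd α coroot l (α i) - α i) + (-A t i : ℚ) • wordProd α coroot l (α t) := by
      simp [H.srefl_root]
      abel
    rw [heq]
    refine ⟨ih₁.add hpos, fun hfix m hm => ?_⟩
    have hsum := heq.symm.trans (sub_eq_zero.2 hfix)
    have h₁ := ih₁.eq_zero_of_add_eq_zero H.linearIndependent hpos hsum
    have h₂ := hpos.eq_zero_of_add_eq_zero H.linearIndependent ih₁ ((add_comm _ _).trans hsum)
    rcases List.mem_append.1 hm with hm | hm
    · exact ih₂ (sub_eq_zero.1 h₁) m hm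
    · obtain rfl := List.mem_singleton.1 hm
      refine (H.zero_iff m i).1 ?_
      rcases smul_eq_zero.1 h₂ with h0 | h0
      · exact_mod_cast neg_eq_zero.1 h0
      · exact absurd (H.wordProd_apply_eq_zero hl.1.left h0) (H.linearIndependent.ne_zero m)

theorem coroot_comp_wordProd_of_orthogonal {i : I} {l : List I}
    (H : IsRealization A α coroot) (h : ∀ m ∈ l, A i m = 0) :
    coroot i ∘ₗ wordProd α coroot l = coroot i := by
  induction l with
  | nil => ext; simp
  | cons k l ih =>
    ext v
    have := LinearMap.congr_fun (ih fun m hm => h m (List.mem_cons_of_mem _ hm)) v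
    simp only [LinearMap.comp_apply] at this
    simp [srefl_apply, H.coroot_root, h k List.mem_cons_self, this]

theorem coroot_comp_wordProd_of_imaginary (H : IsRealization A α coroot) {i j : I} {l : List I}
    (hl : IsRealWord A l) (hi : A i i ≠ 2) (h : wordProd α coroot l (α i) = α j) :
    coroot j ∘ₗ wordProd α coroot l = coroot i := by
  obtain ⟨l', hr, hp⟩ := exists_isReducedWord (α := α) (coroot := coroot) hl
  rw [← hp] at h ⊢
  obtain ⟨h₁, h₂⟩ := H.isNonneg_wordProd_sub hi hr
  obtain rfl : i = j := by
    by_contra hij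
    refine not_isNonneg_neg_root_add H.linearIndependent hij (-1) ?_
    convert h₁ using 1
    rw [h]
    module
  exact H.coroot_comp_wordProd_of_orthogonal (h₂ h)

/-- If `l α_i = α_j` then `l^∨ α_i^∨ = α_j^∨`. -/
theorem coroot_comp_reverse (H : IsRealization A α coroot) {i j : I} {l : List I}
    (hl : IsRealWord A l) (h : wordProd α coroot l (α i) = α j) :
    coroot i ∘ₗ wordProd α coroot l.reverse = coroot j := by
  have hrev : wordProd α coroot l.reverse (α j) = α i := by
    rw [← h]
    exact LinearMap.congr_fun (H.wordProd_reverse_mul hl) (α i)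
  by_cases hj : A j j = 2
  · by_cases hi : A i i = 2
    · exact H.coroot_comp_reverse_of_real hl hi hj h
    · rw [← H.coroot_comp_wordProd_of_imaginary hl hi h, LinearMap.comp_assoc]
      exact congrArg (coroot j ∘ₗ ·) (H.wordProd_mul_reverse hl)
  · exact H.coroot_comp_wordProd_of_imaginary hl.reverse hj hrev

end IsRealization

end GKM

open GKM in
/-- If `w α_i = w̃ α_j` with `w, w̃ ∈ W`, then `w^∨ α_i^∨ = w̃^∨ α_j^∨`, where the dual
action is realized on words via `h ↦ h - h(α_k) • α_k^∨`. -/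
theorem stmt5 {I V : Type*} [Countable I] [AddCommGroup V] [Module ℚ V]
    (A : I → I → ℤ) (α : I → V) (coroot : I → (V →ₗ[ℚ] ℚ))
    (hind : LinearIndependent ℚ α)
    (hpair : ∀ i j, coroot i (α j) = (A i j : ℚ))
    (hdiag : ∀ i, A i i = 2 ∨ A i i ≤ 0)
    (hoff : ∀ i j, i ≠ j → A i j ≤ 0)
    (hzero : ∀ i j, A i j = 0 ↔ A j i = 0)
    (i j : I) (l l' : List I)
    (hl : ∀ m ∈ l, A m m = 2) (hl' : ∀ m ∈ l', A m m = 2)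
    (h : (l.map (srefl α coroot)).prod (α i) =
         (l'.map (srefl α coroot)).prod (α j)) :
    (l.map (crefl α coroot)).prod (coroot i) =
      (l'.map (crefl α coroot)).prod (coroot j) := by
  have H : IsRealization A α coroot := ⟨hind, hpair, hdiag, hoff, hzero⟩
  have hl₂ : IsRealWord A l' := hl'
  have hw : wordProd α coroot (l'.reverse ++ l) (α i) = α j := by
    rw [wordProd_append, Module.End.mul_apply, wordProd, wordProd, h]
    exact LinearMap.congr_fun (H.wordProd_reverse_mul hl₂) (α j)
  rw [crefl_prod_apply, crefl_prod_apply, ← H.coroot_comp_reverse (hl₂.reverse.append hl) hw]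
  ext v
  have := LinearMap.congr_fun (H.wordProd_mul_reverse hl₂) v
  simp only [Module.End.mul_apply, Module.End.one_apply] at this
  simp [this]
end

section
/- Let λ ∈ P^+, μ, ν ∈ Tλ, and suppose there is a sequence ν = ν_s, ν_{s−1}, …, ν_0 = μ (s ≥ 1) in Tλ with ν_{j−1} = r_{β_j}ν_j, β_j ∈ WΠ ∩ Q^+ and β_j^∨(ν_j) > 0 for 1 ≤ j ≤ s. Then for every i ∈ I^{im} one has α_i^∨(μ) ≥ α_i^∨(ν), with equality if and only if α_i^∨(β_j) = 0 for all 1 ≤ j ≤ s (equivalently, r_i commutes with r_{β_j} for all j). -/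
namespace GKM

/-- A functional that is nonpositive on the simple roots is nonpositive on `Q^+`. -/
theorem apply_nonpos_of_mem_Qplus {I V : Type*} [AddCommGroup V] [Module ℚ V] {α : I → V}
    {h : V →ₗ[ℚ] ℚ} (hα : ∀ j, h (α j) ≤ 0) {x : V} (hx : x ∈ Qplus α) : h x ≤ 0 := by
  obtain ⟨n, rfl⟩ := hx
  rw [Finsupp.sum, map_sum]
  refine Finset.sum_nonpos fun j _ => ?_
  rw [map_smul, smul_eq_mul]
  exact mul_nonpos_of_nonneg_of_nonpos (Nat.cast_nonneg _) (hα j)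

/-- The change of a functional along a chain, as a sum over the steps. -/
theorem IsChain.apply_sub_apply {I V : Type*} [AddCommGroup V] [Module ℚ V]
    {A : I → I → ℤ} {α : I → V} {coroot : I → (V →ₗ[ℚ] ℚ)} {lam μ ν : V} {s : ℕ}
    {c β : ℕ → V} {βv : ℕ → (V →ₗ[ℚ] ℚ)}
    (hchain : IsChain A α coroot lam μ ν s c β βv) (h : V →ₗ[ℚ] ℚ) :
    h ν - h μ = ∑ k ∈ Finset.range s, βv k (c (k + 1)) * h (β k) := by
  obtain ⟨rfl, rfl, -, hstep⟩ := hchain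
  rw [← Finset.sum_range_sub fun k => h (c k)]
  refine Finset.sum_congr rfl fun k hk => ?_
  rw [(hstep k (Finset.mem_range.1 hk)).2.2.2, map_sub, map_smul, smul_eq_mul, sub_sub_cancel]

end GKM

open GKM in
/-- Along a chain from `μ` down to `ν` in `Tλ`, for imaginary `i` one has
`α_i^∨(μ) ≥ α_i^∨(ν)`, with equality iff `α_i^∨(β_j) = 0` for every root `β_j` of the
chain (equivalently, `r_i` commutes with every `r_{β_j}`). -/
theorem stmt8 {I V : Type*} [Countable I] [AddCommGroup V] [Module ℚ V]
    (A : I → I → ℤ) (α : I → V) (coroot : I → (V →ₗ[ℚ] ℚ))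
    (hind : LinearIndependent ℚ α)
    (hpair : ∀ i j, coroot i (α j) = (A i j : ℚ))
    (hdiag : ∀ i, A i i = 2 ∨ A i i ≤ 0)
    (hoff : ∀ i j, i ≠ j → A i j ≤ 0)
    (hzero : ∀ i j, A i j = 0 ↔ A j i = 0)
    (lam : V) (hlam : lam ∈ Pplus coroot)
    (μ ν : V) (s : ℕ) (hs : 1 ≤ s)
    (c : ℕ → V) (β : ℕ → V) (βv : ℕ → (V →ₗ[ℚ] ℚ))
    (hchain : IsChain A α coroot lam μ ν s c β βv)
    (i : I) (hi : A i i ≠ 2) :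
    coroot i ν ≤ coroot i μ ∧
    (coroot i μ = coroot i ν ↔ ∀ k < s, coroot i (β k) = 0) := by
  have hα (j : I) : coroot i (α j) ≤ 0 := by
    rw [hpair]
    obtain rfl | hij := eq_or_ne i j
    · exact_mod_cast (hdiag i).resolve_left hi
    · exact_mod_cast hoff i j hij
  have hsum := hchain.apply_sub_apply (coroot i)
  have hpos k (hk : k < s) : 0 < βv k (c (k + 1)) := (hchain.2.2.2 k hk).2.2.1
  have hterm : ∀ k ∈ Finset.range s, βv k (c (k + 1)) * coroot i (β k) ≤ 0 := fun k hk =>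
    have hk := Finset.mem_range.1 hk
    mul_nonpos_of_nonneg_of_nonpos (hpos k hk).le
      (apply_nonpos_of_mem_Qplus hα (hchain.2.2.2 k hk).2.1)
  refine ⟨sub_nonpos.1 (hsum ▸ Finset.sum_nonpos hterm), ?_⟩
  rw [eq_comm, ← sub_eq_zero, hsum, Finset.sum_eq_zero_iff_of_nonpos hterm]
  simp only [Finset.mem_range]
  exact forall₂_congr fun k hk => mul_eq_zero_iff_left (hpos k hk).ne'
end

section
/- Let λ ∈ P^+, 0 < a ≤ 1 rational, and let ν = ν_s, ν_{s−1}, …, ν_0 = μ be an a-chain for (μ, ν) with roots β_1, …, β_s. Then aβ_t^∨(μ) ∈ ℤ for every t with 1 ≤ t ≤ s. -/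
namespace GKM

variable {I V : Type*} [AddCommGroup V] [Module ℚ V]

/-- The root lattice, the `ℤ`-span of the simple roots. -/
def rootLattice (α : I → V) : AddSubgroup V :=
  AddSubgroup.closure (Set.range α)

theorem intCast_smul_mem {L : AddSubgroup V} {x : V} (n : ℤ) (hx : x ∈ L) :
    (n : ℚ) • x ∈ L := by
  rw [Int.cast_smul_eq_zsmul]
  exact L.zsmul_mem hx n

theorem exists_int_of_mem_rootLattice {α : I → V} {h : V →ₗ[ℚ] ℚ}
    (hh : ∀ i, ∃ n : ℤ, h (α i) = n) {x : V} (hx : x ∈ rootLattice α) :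
    ∃ n : ℤ, h x = n := by
  have hle : rootLattice α ≤ (Int.castAddHom ℚ).range.comap h.toAddMonoidHom := by
    rw [rootLattice, AddSubgroup.closure_le]
    rintro _ ⟨i, rfl⟩
    obtain ⟨n, hn⟩ := hh i
    exact ⟨n, hn.symm⟩
  obtain ⟨n, hn⟩ := hle hx
  exact ⟨n, hn.symm⟩

theorem srefl_mem_rootLattice {A : I → I → ℤ} {α : I → V} {coroot : I → (V →ₗ[ℚ] ℚ)}
    (hpair : ∀ i j, coroot i (α j) = (A i j : ℚ)) (i : I) {x : V}
    (hx : x ∈ rootLattice α) : srefl α coroot i x ∈ rootLattice α := by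
  obtain ⟨n, hn⟩ := exists_int_of_mem_rootLattice (fun j => ⟨A i j, hpair i j⟩) hx
  simp only [srefl, LinearMap.sub_apply, LinearMap.id_apply, LinearMap.smulRight_apply, hn]
  exact sub_mem hx (intCast_smul_mem n (AddSubgroup.subset_closure ⟨i, rfl⟩))

theorem IsWRootPres.mem_rootLattice {A : I → I → ℤ} {α : I → V}
    {coroot : I → (V →ₗ[ℚ] ℚ)} (hpair : ∀ i j, coroot i (α j) = (A i j : ℚ))
    {l : List I} {k : I} {β : V} {βv : V →ₗ[ℚ] ℚ}
    (h : IsWRootPres A α coroot l k β βv) : β ∈ rootLattice α := by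
  obtain ⟨-, rfl, -⟩ := h
  induction l with
  | nil => exact AddSubgroup.subset_closure ⟨k, rfl⟩
  | cons m l ih =>
    rw [List.map_cons, List.prod_cons, Module.End.mul_apply]
    exact srefl_mem_rootLattice hpair m ih

theorem IsWRootPres.coroot_int {A : I → I → ℤ} {α : I → V}
    {coroot : I → (V →ₗ[ℚ] ℚ)} (hpair : ∀ i j, coroot i (α j) = (A i j : ℚ))
    {l : List I} {k : I} {β : V} {βv : V →ₗ[ℚ] ℚ}
    (h : IsWRootPres A α coroot l k β βv) (i : I) : ∃ n : ℤ, βv (α i) = n := by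
  obtain ⟨-, -, rfl⟩ := h
  induction l generalizing i with
  | nil => exact ⟨A k i, hpair k i⟩
  | cons m l ih =>
    obtain ⟨p, hp⟩ := ih i
    obtain ⟨q, hq⟩ := ih m
    refine ⟨p - q * A m i, ?_⟩
    rw [List.map_cons, List.prod_cons, Module.End.mul_apply]
    simp [crefl, hp, hq, hpair]

theorem IsAChain.exists_int_step {A : I → I → ℤ} {α : I → V}
    {coroot : I → (V →ₗ[ℚ] ℚ)} {lam : V} {a : ℚ} {μ ν : V} {s : ℕ} {c β : ℕ → V}
    {βv : ℕ → (V →ₗ[ℚ] ℚ)} {ks : ℕ → I}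
    (h : IsAChain A α coroot lam a μ ν s c β βv ks) {k : ℕ} (hk : k < s) :
    ∃ n : ℤ, a * βv k (c (k + 1)) = n := by
  obtain ⟨-, -, hre, him⟩ := h.2.2 k hk
  by_cases hA : A (ks k) (ks k) = 2
  · obtain ⟨n, -, hn⟩ := hre hA
    exact ⟨n, by simpa using hn⟩
  · exact ⟨1, by simpa using him hA⟩

theorem IsAChain.smul_sub_mem_rootLattice {A : I → I → ℤ} {α : I → V}
    {coroot : I → (V →ₗ[ℚ] ℚ)} (hpair : ∀ i j, coroot i (α j) = (A i j : ℚ))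
    {lam : V} {a : ℚ} {μ ν : V} {s : ℕ} {c β : ℕ → V}
    {βv : ℕ → (V →ₗ[ℚ] ℚ)} {ks : ℕ → I}
    (h : IsAChain A α coroot lam a μ ν s c β βv ks) {k : ℕ} (hk : k ≤ s) :
    a • (c k - μ) ∈ rootLattice α := by
  induction k with
  | zero => simp [h.2.1.1]
  | succ k ih =>
    obtain ⟨n, hn⟩ := h.exists_int_step hk
    obtain ⟨l, hl⟩ := (h.2.2 k hk).1
    have hstep : a • (c (k + 1) - μ) = a • (c k - μ) + (n : ℚ) • β k := by
      rw [(h.2.1.2.2.2 k hk).2.2.2, ← hn]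
      module
    rw [hstep]
    exact add_mem (ih (Nat.le_of_succ_le hk)) (intCast_smul_mem n (hl.mem_rootLattice hpair))

end GKM

open GKM in
/-- Along an `a`-chain `ν = ν_s ← ⋯ ← ν_0 = μ`, one has `a β_t^∨(μ) ∈ ℤ` for every `t`. -/
theorem stmt9 {I V : Type*} [Countable I] [AddCommGroup V] [Module ℚ V]
    (A : I → I → ℤ) (α : I → V) (coroot : I → (V →ₗ[ℚ] ℚ))
    (hind : LinearIndependent ℚ α)
    (hpair : ∀ i j, coroot i (α j) = (A i j : ℚ))
    (hdiag : ∀ i, A i i = 2 ∨ A i i ≤ 0)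
    (hoff : ∀ i j, i ≠ j → A i j ≤ 0)
    (hzero : ∀ i j, A i j = 0 ↔ A j i = 0)
    (lam : V) (hlam : lam ∈ Pplus coroot)
    (a : ℚ) (ha0 : 0 < a) (ha1 : a ≤ 1)
    (μ ν : V) (s : ℕ) (c : ℕ → V) (β : ℕ → V) (βv : ℕ → (V →ₗ[ℚ] ℚ)) (ks : ℕ → I)
    (hchain : IsAChain A α coroot lam a μ ν s c β βv ks) :
    ∀ t < s, ∃ n : ℤ, a * βv t μ = (n : ℚ) := by
  intro t ht
  obtain ⟨n, hn⟩ := hchain.exists_int_step ht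
  obtain ⟨l, hl⟩ := (hchain.2.2 t ht).1
  obtain ⟨m, hm⟩ := exists_int_of_mem_rootLattice (hl.coroot_int hpair)
    (hchain.smul_sub_mem_rootLattice hpair (Nat.succ_le_of_lt ht))
  refine ⟨n - m, ?_⟩
  rw [Int.cast_sub, ← hn, ← hm, map_smul, map_sub, smul_eq_mul]
  ring
end
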